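/- The inverse Mills ratio λ is strictly decreasing on ℝ, and the map c ↦ c + λ(c) is strictly increasing on ℝ. -/

import Mathlib

open MeasureTheory ProbabilityTheory Real Set

/-- The standard normal density φ(x) = (2π)^{-1/2} exp(-x²/2). -/
noncomputable def stdNormalPDF (x : ℝ) : ℝ :=
  (Real.sqrt (2 * Real.pi))⁻¹ * Real.exp (-x ^ 2 / 2)

/-- The standard normal cumulative distribution function Φ(x) = ∫_{-∞}^{x} φ(t) dt. -/
noncomputable def stdNormalCDF (x : ℝ) : ℝ :=
  ∫ t in Set.Iic x, stdNormalPDF t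

/-- The inverse Mills ratio λ(x) = φ(x)/Φ(x). -/
noncomputable def invMills (x : ℝ) : ℝ := stdNormalPDF x / stdNormalCDF x

open Filter Topology

lemma StrictMono.pos_of_tendsto_atBot_zero {f : ℝ → ℝ} (hf : StrictMono f)
    (h : Tendsto f atBot (𝓝 0)) (x : ℝ) : 0 < f x :=
  (hf.monotone.le_of_tendsto h (x - 1)).trans_lt (hf (sub_one_lt x))

lemma pos_of_hasDerivAt_pos_of_tendsto_atBot_zero {f f' : ℝ → ℝ}
    (hf : ∀ x, HasDerivAt f (f' x) x) (hf' : ∀ x, 0 < f' x)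
    (h : Tendsto f atBot (𝓝 0)) (x : ℝ) : 0 < f x :=
  (strictMono_of_hasDerivAt_pos hf hf').pos_of_tendsto_atBot_zero h x

lemma stdNormalPDF_eq_gaussianPDFReal : stdNormalPDF = gaussianPDFReal 0 1 := by
  ext x
  simp [stdNormalPDF, gaussianPDFReal]

lemma stdNormalPDF_pos (x : ℝ) : 0 < stdNormalPDF x := by
  unfold stdNormalPDF
  positivity

lemma integrable_stdNormalPDF : Integrable stdNormalPDF :=
  stdNormalPDF_eq_gaussianPDFReal ▸ integrable_gaussianPDFReal 0 1

lemma continuous_stdNormalPDF : Continuous stdNormalPDF := by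
  unfold stdNormalPDF
  fun_prop

lemma hasDerivAt_stdNormalPDF (x : ℝ) :
    HasDerivAt stdNormalPDF (-x * stdNormalPDF x) x := by
  have h : HasDerivAt (fun y : ℝ => -y ^ 2 / 2) (-x) x := by
    refine ((hasDerivAt_pow 2 x).neg.div_const 2).congr_deriv ?_
    simp [neg_div]
  refine (h.exp.const_mul (Real.sqrt (2 * Real.pi))⁻¹).congr_deriv ?_
  simp only [stdNormalPDF]
  ring

lemma hasDerivAt_stdNormalCDF (x : ℝ) : HasDerivAt stdNormalCDF (stdNormalPDF x) x := by
  have h : stdNormalCDF = fun y => (∫ t in (0 : ℝ)..y, stdNormalPDF t) + stdNormalCDF 0 := by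
    ext y
    rw [← intervalIntegral.integral_Iic_sub_Iic integrable_stdNormalPDF.integrableOn
      integrable_stdNormalPDF.integrableOn]
    simp [stdNormalCDF]
  rw [h]
  exact (continuous_stdNormalPDF.integral_hasStrictDerivAt 0 x).hasDerivAt.add_const _

lemma stdNormalCDF_eq_cdf : stdNormalCDF = cdf (gaussianReal 0 1) := by
  ext x
  rw [cdf_eq_real, measureReal_def, gaussianReal_apply_eq_integral 0 one_ne_zero,
    ENNReal.toReal_ofReal (integral_nonneg fun t => gaussianPDFReal_nonneg 0 1 t),
    stdNormalCDF, stdNormalPDF_eq_gaussianPDFReal]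

lemma tendsto_stdNormalCDF_atBot : Tendsto stdNormalCDF atBot (𝓝 0) :=
  stdNormalCDF_eq_cdf ▸ tendsto_cdf_atBot _

lemma stdNormalCDF_pos (x : ℝ) : 0 < stdNormalCDF x :=
  pos_of_hasDerivAt_pos_of_tendsto_atBot_zero hasDerivAt_stdNormalCDF stdNormalPDF_pos
    tendsto_stdNormalCDF_atBot x

lemma stdNormalPDF_lt_exp (x : ℝ) :
    stdNormalPDF x < (Real.sqrt (2 * Real.pi))⁻¹ * Real.exp (x + 1) := by
  unfold stdNormalPDF
  gcongr
  nlinarith [sq_nonneg (x + 1)]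

lemma stdNormalCDF_lt_exp (x : ℝ) :
    stdNormalCDF x < (Real.sqrt (2 * Real.pi))⁻¹ * Real.exp (x + 1) := by
  have hlim : Tendsto (fun y : ℝ => (Real.sqrt (2 * Real.pi))⁻¹ * Real.exp (y + 1) - stdNormalCDF y)
      atBot (𝓝 0) := by
    have := (Real.tendsto_exp_atBot.comp (tendsto_atBot_add_const_right atBot (1 : ℝ) tendsto_id))
    simpa using (this.const_mul (Real.sqrt (2 * Real.pi))⁻¹).sub tendsto_stdNormalCDF_atBot
  refine sub_pos.mp (pos_of_hasDerivAt_pos_of_tendsto_atBot_zero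
    (f' := fun y => (Real.sqrt (2 * Real.pi))⁻¹ * Real.exp (y + 1) - stdNormalPDF y)
    (fun y => ?_) (fun y => sub_pos.mpr (stdNormalPDF_lt_exp y)) hlim x)
  refine (((((hasDerivAt_id y).add_const 1).exp).const_mul
    (Real.sqrt (2 * Real.pi))⁻¹).sub (hasDerivAt_stdNormalCDF y)).congr_deriv ?_
  simp

lemma tendsto_pow_mul_atBot_zero_of_lt_exp {f : ℝ → ℝ} {c : ℝ} (hpos : ∀ x, 0 < f x)
    (hlt : ∀ x, f x < c * Real.exp (x + 1)) (n : ℕ) :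
    Tendsto (fun x => x ^ n * f x) atBot (𝓝 0) := by
  have hlim : Tendsto (fun x : ℝ => c * Real.exp 1 * (|x| ^ n * Real.exp x)) atBot (𝓝 0) := by
    have h := ((Real.tendsto_pow_mul_exp_neg_atTop_nhds_zero n).comp
      tendsto_neg_atBot_atTop).const_mul (c * Real.exp 1)
    rw [mul_zero] at h
    refine h.congr' ?_
    filter_upwards [eventually_le_atBot 0] with x hx
    simp [abs_of_nonpos hx]
  refine squeeze_zero_norm (fun x => ?_) hlim
  rw [norm_mul, norm_pow, Real.norm_eq_abs, Real.norm_eq_abs, abs_of_pos (hpos x)]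
  calc |x| ^ n * f x ≤ |x| ^ n * (c * Real.exp (x + 1)) := by gcongr; exact (hlt x).le
    _ = c * Real.exp 1 * (|x| ^ n * Real.exp x) := by rw [Real.exp_add]; ring

lemma tendsto_pow_mul_stdNormalPDF_atBot (n : ℕ) :
    Tendsto (fun x => x ^ n * stdNormalPDF x) atBot (𝓝 0) :=
  tendsto_pow_mul_atBot_zero_of_lt_exp stdNormalPDF_pos stdNormalPDF_lt_exp n

lemma tendsto_pow_mul_stdNormalCDF_atBot (n : ℕ) :
    Tendsto (fun x => x ^ n * stdNormalCDF x) atBot (𝓝 0) :=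
  tendsto_pow_mul_atBot_zero_of_lt_exp stdNormalCDF_pos stdNormalCDF_lt_exp n

/-- The first partial moment `∫ t in Iic x, (x - t) * φ t` is positive. -/
lemma mul_stdNormalCDF_add_stdNormalPDF_pos (x : ℝ) :
    0 < x * stdNormalCDF x + stdNormalPDF x := by
  refine pos_of_hasDerivAt_pos_of_tendsto_atBot_zero
    (f := fun y => y * stdNormalCDF y + stdNormalPDF y) (fun y => ?_) stdNormalCDF_pos ?_ x
  · refine (((hasDerivAt_id y).mul (hasDerivAt_stdNormalCDF y)).add
      (hasDerivAt_stdNormalPDF y)).congr_deriv ?_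
    simp
  · simpa using (tendsto_pow_mul_stdNormalCDF_atBot 1).add (tendsto_pow_mul_stdNormalPDF_atBot 0)

/-- The second partial moment `∫ t in Iic x, (x - t) ^ 2 * φ t` is positive. -/
lemma one_add_sq_mul_stdNormalCDF_add_pos (x : ℝ) :
    0 < (1 + x ^ 2) * stdNormalCDF x + x * stdNormalPDF x := by
  refine pos_of_hasDerivAt_pos_of_tendsto_atBot_zero
    (f := fun y => (1 + y ^ 2) * stdNormalCDF y + y * stdNormalPDF y)
    (f' := fun y => 2 * (y * stdNormalCDF y + stdNormalPDF y)) (fun y => ?_)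
    (fun y => mul_pos two_pos (mul_stdNormalCDF_add_stdNormalPDF_pos y)) ?_ x
  · refine ((((hasDerivAt_pow 2 y).const_add 1).mul (hasDerivAt_stdNormalCDF y)).add
      ((hasDerivAt_id y).mul (hasDerivAt_stdNormalPDF y))).congr_deriv ?_
    simp
    ring
  · simpa [add_mul] using ((tendsto_pow_mul_stdNormalCDF_atBot 0).add
      (tendsto_pow_mul_stdNormalCDF_atBot 2)).add (tendsto_pow_mul_stdNormalPDF_atBot 1)

lemma stdNormalPDF_mul_lt_stdNormalCDF_sq (x : ℝ) :
    stdNormalPDF x * (x * stdNormalCDF x + stdNormalPDF x) < stdNormalCDF x ^ 2 := by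
  refine sub_pos.mp (pos_of_hasDerivAt_pos_of_tendsto_atBot_zero
    (f := fun y => stdNormalCDF y ^ 2 -
      stdNormalPDF y * (y * stdNormalCDF y + stdNormalPDF y))
    (f' := fun y => stdNormalPDF y * ((1 + y ^ 2) * stdNormalCDF y + y * stdNormalPDF y))
    (fun y => ?_) (fun y => mul_pos (stdNormalPDF_pos y)
      (one_add_sq_mul_stdNormalCDF_add_pos y)) ?_ x)
  · refine (((hasDerivAt_stdNormalCDF y).pow 2).sub ((hasDerivAt_stdNormalPDF y).mul
      (((hasDerivAt_id y).mul (hasDerivAt_stdNormalCDF y)).add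
        (hasDerivAt_stdNormalPDF y)))).congr_deriv ?_
    simp
    ring
  · have hφ := tendsto_pow_mul_stdNormalPDF_atBot 0
    have hG := (tendsto_pow_mul_stdNormalCDF_atBot 1).add hφ
    simpa using (tendsto_stdNormalCDF_atBot.pow 2).sub (hφ.mul hG)

lemma hasDerivAt_invMills (x : ℝ) :
    HasDerivAt invMills
      (-(stdNormalPDF x * (x * stdNormalCDF x + stdNormalPDF x) / stdNormalCDF x ^ 2)) x := by
  refine ((hasDerivAt_stdNormalPDF x).div (hasDerivAt_stdNormalCDF x)
    (stdNormalCDF_pos x).ne').congr_deriv ?_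
  ring

/-- The inverse Mills ratio λ is strictly decreasing on ℝ, and the map `c ↦ c + λ(c)` is
strictly increasing on ℝ. -/
theorem invMills_strictAnti_add_strictMono :
    StrictAnti invMills ∧ StrictMono (fun c : ℝ => c + invMills c) := by
  refine ⟨strictAnti_of_hasDerivAt_neg hasDerivAt_invMills fun x => neg_neg_of_pos ?_,
    strictMono_of_hasDerivAt_pos (fun x => (hasDerivAt_id x).add (hasDerivAt_invMills x))
      fun x => ?_⟩
  · exact div_pos (mul_pos (stdNormalPDF_pos x) (mul_stdNormalCDF_add_stdNormalPDF_pos x))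
      (pow_pos (stdNormalCDF_pos x) 2)
  · rw [← sub_eq_add_neg, sub_pos, div_lt_one (pow_pos (stdNormalCDF_pos x) 2)]
    exact stdNormalPDF_mul_lt_stdNormalCDF_sq x
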